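/- Let J₀, J₁ be the Bessel functions of the first kind of orders 0 and 1 (defined by Jₙ(x) = (1/π)∫₀^π cos(nθ − x sin θ) dθ), let H₀, H₁ be the Struve functions of orders 0 and 1, and let D(x) = H₀(x)·J₁(x) − H₁(x)·J₀(x). Then for all reals c₀, c₁, all 0 ≤ α ≤ β, and all p > 0, the order-one Hankel integral of the linear function c₀ + c₁ r over [α, β] has the closed form: ∫_α^β (c₀ + c₁ r)·J₁(p r)·r dr = (c₀/p²)·(π/2)·(β p·D(β p) − α p·D(α p)) + (c₁/p³)·(2 β p·J₁(β p) − (β p)²·J₀(β p) − 2 α p·J₁(α p) + (α p)²·J₀(α p)). -/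

import Mathlib

open Real MeasureTheory

noncomputable def J0 (x : ℝ) : ℝ := (1 / π) * ∫ θ in (0:ℝ)..π, Real.cos (x * Real.sin θ)

noncomputable def J1 (x : ℝ) : ℝ := (1 / π) * ∫ θ in (0:ℝ)..π, Real.cos (θ - x * Real.sin θ)

noncomputable def H0 (x : ℝ) : ℝ :=
  (2 / π) * ∫ θ in (0:ℝ)..(π / 2), Real.sin (x * Real.cos θ)

noncomputable def H1 (x : ℝ) : ℝ :=
  (2 * x / π) * ∫ θ in (0:ℝ)..(π / 2), Real.sin (x * Real.cos θ) * Real.sin θ ^ 2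

noncomputable def D (x : ℝ) : ℝ := H0 x * J1 x - H1 x * J0 x

theorem hasDerivAt_intervalIntegral_of_bounded {F F' : ℝ → ℝ → ℝ} (a b C x : ℝ)
    (hF : ∀ x, Continuous (F x)) (hF' : ∀ x, Continuous (F' x))
    (hbound : ∀ x θ, |F' x θ| ≤ C) (hderiv : ∀ x θ, HasDerivAt (fun y => F y θ) (F' x θ) x) :
    HasDerivAt (fun y => ∫ θ in a..b, F y θ) (∫ θ in a..b, F' x θ) x :=
  (intervalIntegral.hasDerivAt_integral_of_dominated_loc_of_deriv_le (bound := fun _ => C)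
    Filter.univ_mem
    (.of_forall fun y => (hF y).aestronglyMeasurable)
    ((hF x).intervalIntegrable a b)
    (hF' x).aestronglyMeasurable
    (.of_forall fun θ _ y _ => hbound y θ)
    intervalIntegrable_const
    (.of_forall fun θ _ y _ => hderiv y θ)).2

theorem integral_sin_mul_sin_mul_sin (x : ℝ) :
    ∫ θ in (0:ℝ)..π, Real.sin θ * Real.sin (x * Real.sin θ) =
      ∫ θ in (0:ℝ)..π, Real.cos (θ - x * Real.sin θ) := by
  have hsymm : ∫ θ in (0:ℝ)..π, Real.cos θ * Real.cos (x * Real.sin θ) = 0 := by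
    have h := intervalIntegral.integral_comp_sub_left (a := 0) (b := π)
      (fun θ => Real.cos θ * Real.cos (x * Real.sin θ)) π
    simp only [Real.cos_pi_sub, Real.sin_pi_sub, neg_mul, intervalIntegral.integral_neg,
      sub_self, sub_zero] at h
    linarith
  simp_rw [Real.cos_sub]
  rw [intervalIntegral.integral_add (Continuous.intervalIntegrable (by fun_prop) _ _)
    (Continuous.intervalIntegrable (by fun_prop) _ _), hsymm, zero_add]

theorem hasDerivAt_J0 (x : ℝ) : HasDerivAt J0 (-J1 x) x := by
  have h := (hasDerivAt_intervalIntegral_of_bounded 0 π 1 x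
    (F := fun x θ => Real.cos (x * Real.sin θ))
    (F' := fun x θ => -(Real.sin θ * Real.sin (x * Real.sin θ)))
    (fun _ => by fun_prop) (fun _ => by fun_prop)
    (fun x θ => by
      rw [abs_neg, abs_mul]
      exact mul_le_one₀ (Real.abs_sin_le_one _) (abs_nonneg _) (Real.abs_sin_le_one _))
    (fun x θ => by
      refine HasDerivAt.congr_deriv ((hasDerivAt_mul_const (x := x) (Real.sin θ)).cos) ?_
      ring)).const_mul (1 / π)
  rw [intervalIntegral.integral_neg, integral_sin_mul_sin_mul_sin, mul_neg] at h
  exact h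

theorem hasDerivAt_mul_J1 (x : ℝ) : HasDerivAt (fun y => y * J1 y) (x * J0 x) x := by
  have h := (hasDerivAt_intervalIntegral_of_bounded 0 π 1 x
    (F := fun x θ => Real.cos (θ - x * Real.sin θ))
    (F' := fun x θ => Real.sin θ * Real.sin (θ - x * Real.sin θ))
    (fun _ => by fun_prop) (fun _ => by fun_prop)
    (fun x θ => by
      rw [abs_mul]
      exact mul_le_one₀ (Real.abs_sin_le_one _) (abs_nonneg _) (Real.abs_sin_le_one _))
    (fun x θ => by
      refine HasDerivAt.congr_deriv
        (((hasDerivAt_mul_const (x := x) (Real.sin θ)).const_sub θ).cos) ?_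
      ring)).const_mul (1 / π)
  have hJ1 : HasDerivAt J1 _ x := h
  have hftc : ∫ θ in (0:ℝ)..π, (Real.cos (θ - x * Real.sin θ) +
      x * (Real.sin θ * Real.sin (θ - x * Real.sin θ)) - x * Real.cos (x * Real.sin θ)) = 0 := by
    rw [intervalIntegral.integral_eq_sub_of_hasDerivAt
      (f := fun θ => Real.sin (θ - x * Real.sin θ)) _
      (Continuous.intervalIntegrable (by fun_prop) _ _)]
    · simp
    · intro θ _
      refine HasDerivAt.congr_deriv
        (((hasDerivAt_id θ).sub ((Real.hasDerivAt_sin θ).const_mul x)).sin) ?_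
      have hcos : Real.cos (x * Real.sin θ) = Real.cos θ * Real.cos (θ - x * Real.sin θ) +
          Real.sin θ * Real.sin (θ - x * Real.sin θ) := by
        rw [← Real.cos_sub, sub_sub_cancel]
      simp only [id, Pi.sub_apply]
      rw [hcos]
      ring
  rw [intervalIntegral.integral_sub (Continuous.intervalIntegrable (by fun_prop) _ _)
    (Continuous.intervalIntegrable (by fun_prop) _ _),
    intervalIntegral.integral_add (Continuous.intervalIntegrable (by fun_prop) _ _)
    (Continuous.intervalIntegrable (by fun_prop) _ _),
    intervalIntegral.integral_const_mul, intervalIntegral.integral_const_mul] at hftc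
  refine ((hasDerivAt_id x).mul hJ1).congr_deriv ?_
  simp only [id, J0, J1]
  linear_combination (1 / π) * hftc

theorem continuous_J1 : Continuous J1 := by
  unfold J1
  fun_prop

theorem hasDerivAt_H0 (x : ℝ) : HasDerivAt H0 (2 / π - H1 x) x := by
  have h := (hasDerivAt_intervalIntegral_of_bounded 0 (π / 2) 1 x
    (F := fun x θ => Real.sin (x * Real.cos θ))
    (F' := fun x θ => Real.cos θ * Real.cos (x * Real.cos θ))
    (fun _ => by fun_prop) (fun _ => by fun_prop)
    (fun x θ => by
      rw [abs_mul]
      exact mul_le_one₀ (Real.abs_cos_le_one _) (abs_nonneg _) (Real.abs_cos_le_one _))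
    (fun x θ => by
      refine HasDerivAt.congr_deriv ((hasDerivAt_mul_const (x := x) (Real.cos θ)).sin) ?_
      ring)).const_mul (2 / π)
  have hftc : ∫ θ in (0:ℝ)..(π / 2), (Real.cos θ * Real.cos (x * Real.cos θ) +
      x * (Real.sin (x * Real.cos θ) * Real.sin θ ^ 2)) = 1 := by
    rw [intervalIntegral.integral_eq_sub_of_hasDerivAt
      (f := fun θ => Real.sin θ * Real.cos (x * Real.cos θ)) _
      (Continuous.intervalIntegrable (by fun_prop) _ _)]
    · simp
    · intro θ _
      refine HasDerivAt.congr_deriv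
        ((Real.hasDerivAt_sin θ).mul ((Real.hasDerivAt_cos θ).const_mul x).cos) ?_
      ring
  rw [intervalIntegral.integral_add (Continuous.intervalIntegrable (by fun_prop) _ _)
    (Continuous.intervalIntegrable (by fun_prop) _ _),
    intervalIntegral.integral_const_mul] at hftc
  refine HasDerivAt.congr_deriv (f := H0) h ?_
  simp only [H1]
  linear_combination (2 / π) * hftc

theorem hasDerivAt_mul_H1 (x : ℝ) : HasDerivAt (fun y => y * H1 y) (x * H0 x) x := by
  have h := hasDerivAt_intervalIntegral_of_bounded 0 (π / 2) 1 x
    (F := fun x θ => Real.sin (x * Real.cos θ) * Real.sin θ ^ 2)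
    (F' := fun x θ => Real.cos θ * Real.cos (x * Real.cos θ) * Real.sin θ ^ 2)
    (fun _ => by fun_prop) (fun _ => by fun_prop)
    (fun x θ => by
      rw [abs_mul, abs_mul, abs_pow]
      exact mul_le_one₀
        (mul_le_one₀ (Real.abs_cos_le_one _) (abs_nonneg _) (Real.abs_cos_le_one _))
        (by positivity) (pow_le_one₀ (abs_nonneg _) (Real.abs_sin_le_one _)))
    (fun x θ => by
      refine HasDerivAt.congr_deriv
        (((hasDerivAt_mul_const (x := x) (Real.cos θ)).sin).mul_const (Real.sin θ ^ 2)) ?_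
      ring)
  have hftc : ∫ θ in (0:ℝ)..(π / 2), (2 * (Real.sin (x * Real.cos θ) * Real.sin θ ^ 2) +
      x * (Real.cos θ * Real.cos (x * Real.cos θ) * Real.sin θ ^ 2) -
      Real.sin (x * Real.cos θ)) = 0 := by
    rw [intervalIntegral.integral_eq_sub_of_hasDerivAt
      (f := fun θ => -(Real.sin θ * Real.cos θ * Real.sin (x * Real.cos θ))) _
      (Continuous.intervalIntegrable (by fun_prop) _ _)]
    · simp
    · intro θ _
      refine (((Real.hasDerivAt_sin θ).mul (Real.hasDerivAt_cos θ)).mul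
        ((Real.hasDerivAt_cos θ).const_mul x).sin).neg.congr_deriv ?_
      rw [Pi.mul_apply]
      linear_combination (-Real.sin (x * Real.cos θ)) * Real.sin_sq_add_cos_sq θ
  rw [intervalIntegral.integral_sub (Continuous.intervalIntegrable (by fun_prop) _ _)
    (Continuous.intervalIntegrable (by fun_prop) _ _),
    intervalIntegral.integral_add (Continuous.intervalIntegrable (by fun_prop) _ _)
    (Continuous.intervalIntegrable (by fun_prop) _ _),
    intervalIntegral.integral_const_mul, intervalIntegral.integral_const_mul] at hftc
  refine ((hasDerivAt_id x).mul
    ((((hasDerivAt_id x).const_mul 2).div_const π).mul h)).congr_deriv ?_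
  simp only [id, H0, Pi.mul_apply]
  linear_combination (2 * x / π) * hftc

theorem hasDerivAt_mul_D (x : ℝ) :
    HasDerivAt (fun y => π / 2 * (y * D y)) (x * J1 x) x := by
  have h := (((hasDerivAt_H0 x).mul (hasDerivAt_mul_J1 x)).sub
    ((hasDerivAt_mul_H1 x).mul (hasDerivAt_J0 x))).const_mul (π / 2)
  refine (h.congr_deriv ?_).congr_of_eventuallyEq (.of_forall fun y => ?_)
  · field_simp
    ring
  · simp only [D, Pi.sub_apply, Pi.mul_apply]
    ring

theorem hasDerivAt_two_mul_J1_sub_sq_mul_J0 (x : ℝ) :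
    HasDerivAt (fun y => 2 * (y * J1 y) - y ^ 2 * J0 y) (x ^ 2 * J1 x) x := by
  refine (((hasDerivAt_mul_J1 x).const_mul 2).sub
    ((hasDerivAt_pow 2 x).mul (hasDerivAt_J0 x))).congr_deriv ?_
  push_cast
  ring

theorem hankel_linear_J1 (c₀ c₁ α β p : ℝ) (hα : 0 ≤ α) (hαβ : α ≤ β) (hp : 0 < p) :
    ∫ r in α..β, (c₀ + c₁ * r) * J1 (p * r) * r =
      (c₀ / p ^ 2) * (π / 2) * (β * p * D (β * p) - α * p * D (α * p)) +
      (c₁ / p ^ 3) * (2 * (β * p) * J1 (β * p) - (β * p) ^ 2 * J0 (β * p) -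
        2 * (α * p) * J1 (α * p) + (α * p) ^ 2 * J0 (α * p)) := by
  have hG : ∀ r, HasDerivAt (fun r => c₀ / p ^ 2 * (π / 2 * (r * p * D (r * p))) +
      c₁ / p ^ 3 * (2 * (r * p * J1 (r * p)) - (r * p) ^ 2 * J0 (r * p)))
      ((c₀ + c₁ * r) * J1 (p * r) * r) r := by
    intro r
    have hmul : HasDerivAt (fun r => r * p) p r := hasDerivAt_mul_const p
    refine ((((hasDerivAt_mul_D (r * p)).comp r hmul).const_mul (c₀ / p ^ 2)).add
      (((hasDerivAt_two_mul_J1_sub_sq_mul_J0 (r * p)).comp r hmul).const_mul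
        (c₁ / p ^ 3))).congr_deriv ?_
    rw [mul_comm p r]
    field_simp
  have hcont : Continuous fun r => (c₀ + c₁ * r) * J1 (p * r) * r := by
    have := continuous_J1
    fun_prop
  rw [intervalIntegral.integral_eq_sub_of_hasDerivAt (fun r _ => hG r)
    (hcont.intervalIntegrable _ _)]
  ring
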